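/- arXiv:1411.1165 — 2 statements merged into one kernel-verified Lean document; each statement's English description precedes it below -/
import Mathlib

section
/- For every natural number n, every λ ∈ (0,1], and every α > 0, the minimizer of d_α(·, q_λ) among pmfs supported on {0,1,…,n} is unique: if p is a probability mass function on ℕ supported on {0,1,…,n} and p ≠ p_{n;λ}, then d_α(p, q_λ) > d_α(p_{n;λ}, q_λ), where q_λ is the Poisson(λ) pmf. -/
open scoped BigOperators ENNReal

/-- A probability mass function on ℕ. -/
def IsPmf (p : ℕ → ℝ) : Prop := (∀ j, 0 ≤ p j) ∧ ∑' j, p j = 1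

/-- Total variation distance between two pmfs on ℕ. -/
noncomputable def dtv (p q : ℕ → ℝ) : ℝ := (1 / 2) * ∑' j, |p j - q j|

/-- Descending factorial (j)_k = j(j-1)⋯(j-k+1), as a real number. -/
noncomputable def descFac (j k : ℕ) : ℝ := ∏ i ∈ Finset.range k, ((j : ℝ) - i)

/-- k-th descending factorial moment of a pmf p. -/
noncomputable def facMoment (k : ℕ) (p : ℕ → ℝ) : ℝ := ∑' j, descFac j k * p j

/-- Factorial moment distance of order α, with values in [0,∞]:
    d_α(p,q) = ∑_{k=1}^∞ (α^{k-1}/k!) |M_k(p) - M_k(q)|. -/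
noncomputable def dFM (α : ℝ) (p q : ℕ → ℝ) : ℝ≥0∞ :=
  ∑' k : ℕ, ENNReal.ofReal
    (α ^ k / (Nat.factorial (k + 1) : ℝ) * |facMoment (k + 1) p - facMoment (k + 1) q|)

/-- The Poisson(λ) pmf. -/
noncomputable def poissonPmf (lam : ℝ) (j : ℕ) : ℝ :=
  Real.exp (-lam) * lam ^ j / (Nat.factorial j : ℝ)

/-- The generalized matching pmf p_{n;λ}. -/
noncomputable def genMatch (n : ℕ) (lam : ℝ) (j : ℕ) : ℝ :=
  if j ≤ n then
    lam ^ j / (Nat.factorial j : ℝ) * ∑ i ∈ Finset.range (n - j + 1), (-lam) ^ i / (Nat.factorial i : ℝ)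
  else 0

lemma descFac_eq_descFactorial (j k : ℕ) : descFac j k = (j.descFactorial k : ℝ) := by
  rw [descFac, ← descPochhammer_eval_eq_prod_range, descPochhammer_eval_eq_descFactorial]

lemma descFac_of_lt {j k : ℕ} (h : j < k) : descFac j k = 0 := by
  rw [descFac_eq_descFactorial, Nat.descFactorial_of_lt h, Nat.cast_zero]

lemma descFac_add_div_factorial (k m : ℕ) :
    descFac (m + k) k / ((m + k).factorial : ℝ) = 1 / (m.factorial : ℝ) := by
  have h : (m.factorial : ℝ) * ((m + k).descFactorial k : ℝ) = (m + k).factorial := by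
    have := Nat.factorial_mul_descFactorial (Nat.le_add_left k m)
    rw [Nat.add_sub_cancel] at this
    exact_mod_cast this
  rw [descFac_eq_descFactorial, div_eq_div_iff (by positivity) (by positivity)]
  linarith

lemma facMoment_eq_sum {n : ℕ} {p : ℕ → ℝ} (hsupp : ∀ j, n < j → p j = 0) (k : ℕ) :
    facMoment k p = ∑ j ∈ Finset.range (n + 1), descFac j k * p j := by
  refine tsum_eq_sum fun j hj => ?_
  rw [hsupp j (by rw [Finset.mem_range] at hj; omega), mul_zero]

lemma facMoment_eq_zero {n k : ℕ} {p : ℕ → ℝ} (hsupp : ∀ j, n < j → p j = 0) (hk : n < k) :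
    facMoment k p = 0 := by
  rw [facMoment_eq_sum hsupp]
  refine Finset.sum_eq_zero fun j hj => ?_
  rw [descFac_of_lt (by have := Finset.mem_range.mp hj; omega), zero_mul]

lemma facMoment_poissonPmf (lam : ℝ) (k : ℕ) : facMoment k (poissonPmf lam) = lam ^ k := by
  have hshift (m : ℕ) : descFac (m + k) k * poissonPmf lam (m + k) =
      Real.exp (-lam) * lam ^ k * (lam ^ m / (m.factorial : ℝ)) := by
    have h := descFac_add_div_factorial k m
    calc descFac (m + k) k * poissonPmf lam (m + k)
        = Real.exp (-lam) * lam ^ k * lam ^ m *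
            (descFac (m + k) k / ((m + k).factorial : ℝ)) := by
          unfold poissonPmf; ring
      _ = _ := by rw [h]; ring
  have hexp : HasSum (fun m : ℕ => lam ^ m / (m.factorial : ℝ)) (Real.exp lam) := by
    rw [Real.exp_eq_exp_ℝ]
    exact NormedSpace.expSeries_div_hasSum_exp lam
  have hsum : HasSum (fun m : ℕ => descFac (m + k) k * poissonPmf lam (m + k)) (lam ^ k) := by
    simp_rw [hshift]
    have hval : Real.exp (-lam) * lam ^ k * Real.exp lam = lam ^ k := by
      rw [mul_right_comm, ← Real.exp_add, neg_add_cancel, Real.exp_zero, one_mul]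
    have h := hexp.mul_left (Real.exp (-lam) * lam ^ k)
    rwa [hval] at h
  have hsum_zero : ∑ j ∈ Finset.range k, descFac j k * poissonPmf lam j = 0 :=
    Finset.sum_eq_zero fun j hj => by rw [descFac_of_lt (Finset.mem_range.mp hj), zero_mul]
  have h := (hasSum_nat_add_iff (f := fun j => descFac j k * poissonPmf lam j) k).mp hsum
  rw [hsum_zero, add_zero] at h
  exact h.tsum_eq

lemma genMatch_of_lt {n : ℕ} (lam : ℝ) : ∀ j, n < j → genMatch n lam j = 0 := fun _ hj =>
  if_neg (not_le.mpr hj)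

/-- The truncated Cauchy product of the exponential series at `x` and `-x` is `1`. -/
lemma sum_exp_mul_sum_exp_neg (x : ℝ) (N : ℕ) :
    ∑ m ∈ Finset.range (N + 1), x ^ m / (m.factorial : ℝ) *
      ∑ i ∈ Finset.range (N - m + 1), (-x) ^ i / (i.factorial : ℝ) = 1 := by
  have hdiag (s : ℕ) : ∑ m ∈ Finset.range (s + 1),
      x ^ m / (m.factorial : ℝ) * ((-x) ^ (s - m) / ((s - m).factorial : ℝ)) =
      (x + -x) ^ s / (s.factorial : ℝ) := by
    rw [add_pow, Finset.sum_div]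
    refine Finset.sum_congr rfl fun m hm => ?_
    rw [Nat.cast_choose ℝ (Nat.lt_succ_iff.mp (Finset.mem_range.mp hm))]
    field_simp
  induction N with
  | zero => simp
  | succ N ih =>
    have hstep : ∀ m ∈ Finset.range (N + 1), x ^ m / (m.factorial : ℝ) *
        ∑ i ∈ Finset.range (N + 1 - m + 1), (-x) ^ i / (i.factorial : ℝ) =
        x ^ m / (m.factorial : ℝ) *
          ∑ i ∈ Finset.range (N - m + 1), (-x) ^ i / (i.factorial : ℝ) +
        x ^ m / (m.factorial : ℝ) *
          ((-x) ^ (N + 1 - m) / ((N + 1 - m).factorial : ℝ)) := fun m hm => by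
      have hm' : N + 1 - m = N - m + 1 := by have := Finset.mem_range.mp hm; omega
      rw [Finset.sum_range_succ, hm', mul_add]
    have h := hdiag (N + 1)
    rw [Finset.sum_range_succ, add_neg_cancel, zero_pow N.succ_ne_zero, zero_div] at h
    rw [Finset.sum_range_succ, Finset.sum_congr rfl hstep, Finset.sum_add_distrib, ih, add_assoc,
      add_eq_left]
    simpa using h

lemma facMoment_genMatch {n k : ℕ} (lam : ℝ) (hk : k ≤ n) :
    facMoment k (genMatch n lam) = lam ^ k := by
  obtain ⟨N, rfl⟩ := Nat.exists_eq_add_of_le hk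
  rw [facMoment_eq_sum (genMatch_of_lt lam), add_assoc, Finset.sum_range_add,
    Finset.sum_eq_zero fun j hj => by rw [descFac_of_lt (Finset.mem_range.mp hj), zero_mul],
    zero_add, ← mul_one (lam ^ k), ← sum_exp_mul_sum_exp_neg lam N, Finset.mul_sum]
  refine Finset.sum_congr rfl fun m hm => ?_
  have hm' : m ≤ N := Nat.lt_succ_iff.mp (Finset.mem_range.mp hm)
  have h := descFac_add_div_factorial k m
  rw [genMatch, if_pos (by omega), show k + N - (k + m) = N - m by omega, add_comm k m, pow_add]
  calc _ = lam ^ k * lam ^ m * (descFac (m + k) k / ((m + k).factorial : ℝ)) *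
        ∑ i ∈ Finset.range (N - m + 1), (-lam) ^ i / (i.factorial : ℝ) := by ring
    _ = _ := by rw [h]; ring

/-- A function supported on `{0, …, n}` is determined by its first factorial moments. -/
lemma eq_of_facMoment_eq {n : ℕ} {p q : ℕ → ℝ} (hp : ∀ j, n < j → p j = 0)
    (hq : ∀ j, n < j → q j = 0) (h : ∀ k ≤ n, facMoment k p = facMoment k q) : p = q := by
  have key (d : ℕ) : ∀ j, n < j + d → p j = q j := by
    induction d with
    | zero => exact fun j hj => (hp j hj).trans (hq j hj).symm
    | succ d ih =>
      intro j hj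
      rcases lt_or_ge n j with hnj | hjn
      · exact (hp j hnj).trans (hq j hnj).symm
      have hj0 : descFac j j ≠ 0 := by
        rw [descFac_eq_descFactorial, Nat.descFactorial_self]
        positivity
      have hsum := h j hjn
      rw [facMoment_eq_sum hp, facMoment_eq_sum hq, ← sub_eq_zero, ← Finset.sum_sub_distrib,
        Finset.sum_eq_single_of_mem j (Finset.mem_range.mpr (by omega))] at hsum
      · exact mul_left_cancel₀ hj0 (sub_eq_zero.mp hsum)
      · intro i _ hij
        rcases lt_or_gt_of_ne hij with hlt | hgt
        · rw [descFac_of_lt hlt]; ring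
        · rw [ih i (by omega)]; ring
  funext j
  exact key (n + 1) j (by omega)

lemma facMoment_zero (p : ℕ → ℝ) : facMoment 0 p = ∑' j, p j := by
  simp [facMoment, descFac]

lemma dFM_genMatch_poissonPmf_ne_top (n : ℕ) {lam α : ℝ} (hlam : 0 ≤ lam) (hα : 0 ≤ α) :
    dFM α (genMatch n lam) (poissonPmf lam) ≠ ⊤ := by
  refine Summable.tsum_ofReal_ne_top (Summable.of_nonneg_of_le (fun k => by positivity)
    (fun k => ?_) ((Real.summable_pow_div_factorial (α * lam)).mul_left lam))
  have habs : |facMoment (k + 1) (genMatch n lam) - facMoment (k + 1) (poissonPmf lam)| ≤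
      lam ^ (k + 1) := by
    rw [facMoment_poissonPmf]
    rcases le_or_gt (k + 1) n with hk | hk
    · rw [facMoment_genMatch lam hk, sub_self, abs_zero]
      positivity
    · rw [facMoment_eq_zero (genMatch_of_lt lam) hk, zero_sub, abs_neg,
        abs_of_nonneg (by positivity)]
  calc _ ≤ α ^ k / (k.factorial : ℝ) * lam ^ (k + 1) := by
        gcongr
        exact Nat.le_succ k
    _ = _ := by ring

theorem stmt11 (n : ℕ) (lam : ℝ) (hlam : 0 < lam ∧ lam ≤ 1) (α : ℝ) (hα : 0 < α)
    (p : ℕ → ℝ) (hp : IsPmf p) (hsupp : ∀ j, n < j → p j = 0)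
    (hne : p ≠ genMatch n lam) :
    dFM α (genMatch n lam) (poissonPmf lam) < dFM α p (poissonPmf lam) := by
  obtain ⟨hlam0, -⟩ := hlam
  obtain ⟨k, hkn, hk⟩ : ∃ k ≤ n, facMoment k p ≠ facMoment k (genMatch n lam) := by
    by_contra! h
    exact hne (eq_of_facMoment_eq hsupp (genMatch_of_lt lam) h)
  rw [facMoment_genMatch lam hkn] at hk
  obtain ⟨m, rfl⟩ := Nat.exists_eq_succ_of_ne_zero
    (show k ≠ 0 by rintro rfl; exact hk (by rw [facMoment_zero, hp.2, pow_zero]))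
  refine ENNReal.tsum_lt_tsum (i := m) (dFM_genMatch_poissonPmf_ne_top n hlam0.le hα.le)
    (fun i => ENNReal.ofReal_le_ofReal ?_) ?_
  · rcases le_or_gt (i + 1) n with hi | hi
    · rw [facMoment_genMatch lam hi, facMoment_poissonPmf, sub_self, abs_zero, mul_zero]
      positivity
    · rw [facMoment_eq_zero (genMatch_of_lt lam) hi, facMoment_eq_zero hsupp hi]
  · rw [facMoment_genMatch lam hkn, facMoment_poissonPmf, sub_self, abs_zero, mul_zero,
      ENNReal.ofReal_zero, ENNReal.ofReal_pos]
    have := abs_pos.mpr (sub_ne_zero.mpr hk)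
    positivity
end

section
/- For every λ ∈ (0,1], letting d_tv(n) = d_tv(p_{n;λ}, q_λ), one has, as n → ∞: d_tv(n) · (n+1)!/(2^n λ^{n+1}) → 1; more precisely, (d_tv(n) · (n+1)!/(2^n λ^{n+1}) − 1 + 2λ/(n+2)) · n → 0 as n → ∞. -/
open scoped BigOperators ENNReal

/-- The remainder `e^{-x} - ∑_{i<k} (-x)^i/i!`, with the sign that makes it nonnegative. -/
noncomputable def expRem (x : ℝ) (k : ℕ) : ℝ :=
  (-1) ^ k * (Real.exp (-x) - ∑ i ∈ Finset.range k, (-x) ^ i / (Nat.factorial i : ℝ))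

lemma expRem_add_succ (x : ℝ) (k : ℕ) :
    expRem x k + expRem x (k + 1) = x ^ k / (Nat.factorial k : ℝ) := by
  have h : (-1 : ℝ) ^ k * (-1) ^ k = 1 := by rw [← mul_pow]; norm_num
  unfold expRem
  rw [Finset.sum_range_succ, neg_pow x k, pow_succ]
  linear_combination (x ^ k / (Nat.factorial k : ℝ)) * h

lemma expRem_nonneg {x : ℝ} (h0 : 0 ≤ x) (h1 : x ≤ 1) (k : ℕ) : 0 ≤ expRem x k := by
  have hanti : Antitone fun i : ℕ => x ^ i / (Nat.factorial i : ℝ) := by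
    intro a b hab
    have := pow_le_pow_of_le_one h0 h1 hab
    have := Nat.factorial_le hab
    dsimp only
    gcongr
  have hsum : ∀ n, ∑ i ∈ Finset.range n, (-1) ^ i * (x ^ i / (Nat.factorial i : ℝ)) =
      ∑ i ∈ Finset.range n, (-x) ^ i / (Nat.factorial i : ℝ) := fun n =>
    Finset.sum_congr rfl fun i _ => by rw [neg_pow x i, mul_div_assoc]
  have hlim : Filter.Tendsto
      (fun n => ∑ i ∈ Finset.range n, (-1) ^ i * (x ^ i / (Nat.factorial i : ℝ)))
      Filter.atTop (nhds (Real.exp (-x))) := by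
    have h := (NormedSpace.expSeries_div_hasSum_exp (-x)).tendsto_sum_nat
    rw [← Real.exp_eq_exp_ℝ] at h
    simpa only [hsum] using h
  unfold expRem
  rcases Nat.even_or_odd' k with ⟨m, rfl | rfl⟩
  · have h := hanti.alternating_series_le_tendsto hlim m
    rw [hsum] at h
    rw [pow_mul]
    norm_num
    exact h
  · have h := hanti.tendsto_le_alternating_series hlim m
    rw [hsum] at h
    rw [pow_succ, pow_mul]
    norm_num
    exact h

lemma abs_genMatch_sub_poissonPmf_of_le {x : ℝ} (h0 : 0 ≤ x) (h1 : x ≤ 1) {n j : ℕ} (hj : j ≤ n) :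
    |genMatch n x j - poissonPmf x j| =
      x ^ j / (Nat.factorial j : ℝ) * expRem x (n + 1 - j) := by
  rw [← abs_of_nonneg (expRem_nonneg h0 h1 (n + 1 - j)), expRem, abs_mul, abs_neg_one_pow, one_mul,
    ← abs_of_nonneg (by positivity : 0 ≤ x ^ j / (Nat.factorial j : ℝ)), ← abs_mul, abs_sub_comm,
    genMatch, if_pos hj,
    poissonPmf, Nat.sub_add_comm hj]
  congr 1
  ring

lemma abs_genMatch_sub_poissonPmf_of_lt {x : ℝ} (h0 : 0 ≤ x) {n j : ℕ} (hj : n < j) :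
    |genMatch n x j - poissonPmf x j| = poissonPmf x j := by
  have : 0 ≤ poissonPmf x j := by unfold poissonPmf; positivity
  rw [genMatch, if_neg hj.not_ge, zero_sub, abs_neg, abs_of_nonneg this]

lemma hasSum_poissonPmf (x : ℝ) : HasSum (poissonPmf x) 1 := by
  have h := (NormedSpace.expSeries_div_hasSum_exp x).mul_left (Real.exp (-x))
  rw [← Real.exp_eq_exp_ℝ, ← Real.exp_add, neg_add_cancel, Real.exp_zero] at h
  rwa [show poissonPmf x = fun i => Real.exp (-x) * (x ^ i / (Nat.factorial i : ℝ)) from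
    funext fun i => mul_div_assoc _ _ _]

lemma tsum_poissonPmf_add_le {x : ℝ} (h0 : 0 ≤ x) (k : ℕ) :
    ∑' i, poissonPmf x (i + k) ≤ x ^ k / (Nat.factorial k : ℝ) := by
  have h := (hasSum_poissonPmf x).mul_left (x ^ k / (Nat.factorial k : ℝ))
  rw [mul_one] at h
  rw [← h.tsum_eq]
  refine Summable.tsum_le_tsum (fun i => ?_)
    ((summable_nat_add_iff k).2 (hasSum_poissonPmf x).summable) h.summable
  have hf : (Nat.factorial i : ℝ) * Nat.factorial k ≤ Nat.factorial (i + k) := by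
    exact_mod_cast Nat.le_of_dvd (Nat.factorial_pos _)
      (Nat.factorial_mul_factorial_dvd_factorial_add i k)
  calc poissonPmf x (i + k)
      ≤ Real.exp (-x) * x ^ (i + k) / (Nat.factorial i * Nat.factorial k) := by
        unfold poissonPmf; gcongr
    _ = x ^ k / (Nat.factorial k : ℝ) * poissonPmf x i := by
        unfold poissonPmf; field_simp; ring

lemma two_mul_dtv_genMatch_poissonPmf {x : ℝ} (h0 : 0 ≤ x) (h1 : x ≤ 1) (n : ℕ) :
    2 * dtv (genMatch n x) (poissonPmf x) =
      ∑ j ∈ Finset.range (n + 1), x ^ j / (Nat.factorial j : ℝ) * expRem x (n + 1 - j) +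
        ∑' i, poissonPmf x (i + (n + 1)) := by
  have htail : ∀ i, |genMatch n x (i + (n + 1)) - poissonPmf x (i + (n + 1))| =
      poissonPmf x (i + (n + 1)) := fun i => abs_genMatch_sub_poissonPmf_of_lt h0 (by omega)
  have hs : Summable fun j => |genMatch n x j - poissonPmf x j| := by
    rw [← summable_nat_add_iff (n + 1)]
    simp only [htail]
    exact (summable_nat_add_iff (n + 1)).2 (hasSum_poissonPmf x).summable
  rw [dtv, ← hs.sum_add_tsum_nat_add (n + 1)]
  simp only [htail]
  rw [Finset.sum_congr rfl fun j hj =>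
    abs_genMatch_sub_poissonPmf_of_le h0 h1 (Nat.lt_succ_iff.1 (Finset.mem_range.1 hj))]
  ring

lemma sum_pow_div_factorial_mul (x : ℝ) (N : ℕ) :
    ∑ j ∈ Finset.range (N + 1),
      x ^ j / (Nat.factorial j : ℝ) * (x ^ (N - j) / (Nat.factorial (N - j) : ℝ)) =
      (2 * x) ^ N / (Nat.factorial N : ℝ) := by
  rw [two_mul, add_pow, Finset.sum_div]
  refine Finset.sum_congr rfl fun j hj => ?_
  rw [Nat.cast_choose ℝ (Nat.lt_succ_iff.1 (Finset.mem_range.1 hj))]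
  field_simp

lemma abs_two_mul_dtv_sub_le {x : ℝ} (h0 : 0 ≤ x) (h1 : x ≤ 1) (n : ℕ) :
    |2 * dtv (genMatch n x) (poissonPmf x) -
        ((2 * x) ^ (n + 1) / (Nat.factorial (n + 1) : ℝ) -
          (2 * x) ^ (n + 2) / (Nat.factorial (n + 2) : ℝ))| ≤
      (2 * x) ^ (n + 3) / (Nat.factorial (n + 3) : ℝ) +
        3 * (x ^ (n + 1) / (Nat.factorial (n + 1) : ℝ)) := by
  set t : ℕ → ℝ := fun i => x ^ i / (Nat.factorial i : ℝ) with ht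
  have ht0 : ∀ i, 0 ≤ t i := fun i => by simp only [ht]; positivity
  have hrem : ∀ j ∈ Finset.range (n + 1), t j * expRem x (n + 1 - j) =
      t j * t (n + 1 - j) - t j * t (n + 2 - j) + t j * expRem x (n + 3 - j) := by
    intro j hj
    have hj' := Finset.mem_range.1 hj
    rw [show n + 2 - j = n + 1 - j + 1 by omega, show n + 3 - j = n + 1 - j + 1 + 1 by omega]
    have a := expRem_add_succ x (n + 1 - j)
    have b := expRem_add_succ x (n + 1 - j + 1)
    simp only [ht]
    linear_combination (x ^ j / (Nat.factorial j : ℝ)) * (a - b)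
  have hlast0 : 0 ≤ ∑ j ∈ Finset.range (n + 1), t j * expRem x (n + 3 - j) :=
    Finset.sum_nonneg fun j _ => mul_nonneg (ht0 j) (expRem_nonneg h0 h1 _)
  have hlast1 : ∑ j ∈ Finset.range (n + 1), t j * expRem x (n + 3 - j) ≤
      (2 * x) ^ (n + 3) / (Nat.factorial (n + 3) : ℝ) := by
    rw [← sum_pow_div_factorial_mul x (n + 3)]
    calc _ ≤ ∑ j ∈ Finset.range (n + 1), t j * t (n + 3 - j) := by
          refine Finset.sum_le_sum fun j _ => mul_le_mul_of_nonneg_left ?_ (ht0 j)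
          have := expRem_add_succ x (n + 3 - j)
          have := expRem_nonneg h0 h1 (n + 3 - j + 1)
          simp only [ht]
          linarith
      _ ≤ _ := Finset.sum_le_sum_of_subset_of_nonneg (Finset.range_mono (by omega))
          fun j _ _ => mul_nonneg (ht0 _) (ht0 _)
  have hA := sum_pow_div_factorial_mul x (n + 1)
  have hB := sum_pow_div_factorial_mul x (n + 2)
  rw [Finset.sum_range_succ] at hA hB
  rw [Finset.sum_range_succ] at hB
  have hD := two_mul_dtv_genMatch_poissonPmf h0 h1 n
  rw [Finset.sum_congr rfl hrem, Finset.sum_add_distrib, Finset.sum_sub_distrib] at hD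
  have hT := tsum_poissonPmf_add_le h0 (n + 1)
  have hT0 : 0 ≤ ∑' i, poissonPmf x (i + (n + 1)) :=
    tsum_nonneg fun i => by unfold poissonPmf; positivity
  have hx : t (n + 1) * x ≤ t (n + 1) := mul_le_of_le_one_right (ht0 _) h1
  have hx0 : 0 ≤ t (n + 1) * x := mul_nonneg (ht0 _) h0
  have hy : t (n + 2) ≤ t (n + 1) * x := by
    have : (Nat.factorial (n + 1) : ℝ) ≤ Nat.factorial (n + 2) := by
      exact_mod_cast Nat.factorial_le (by omega)
    simp only [ht]
    rw [div_mul_eq_mul_div, ← pow_succ]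
    gcongr
  have hy0 := ht0 (n + 2)
  simp only [Nat.sub_self, show n + 2 - (n + 1) = 1 by omega, pow_zero, pow_one,
    Nat.factorial_zero, Nat.factorial_one, Nat.cast_one, div_one, mul_one] at hA hB
  simp only [ht] at *
  rw [abs_le]
  constructor <;> linarith

lemma abs_normalized_dtv_sub_le {x : ℝ} (h0 : 0 < x) (h1 : x ≤ 1) (n : ℕ) :
    |dtv (genMatch n x) (poissonPmf x) * (Nat.factorial (n + 1) : ℝ) / (2 ^ n * x ^ (n + 1)) - 1 +
        2 * x / ((n : ℝ) + 2)| ≤ 4 / (((n : ℝ) + 2) * (n + 3)) + 3 * (1 / 2) ^ (n + 1) := by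
  have hA : 0 < (2 * x) ^ (n + 1) / (Nat.factorial (n + 1) : ℝ) := by positivity
  have h := div_le_div_of_nonneg_right (abs_two_mul_dtv_sub_le h0.le h1 n) hA.le
  rw [← abs_of_pos hA, ← abs_div, abs_of_pos hA] at h
  have e2 : (Nat.factorial (n + 2) : ℝ) = (n + 2) * Nat.factorial (n + 1) := by
    rw [Nat.factorial_succ (n + 1)]; push_cast; ring
  have e3 : (Nat.factorial (n + 3) : ℝ) = (n + 3) * ((n + 2) * Nat.factorial (n + 1)) := by
    rw [Nat.factorial_succ (n + 2), Nat.cast_mul, e2]; push_cast; ring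
  rw [e2, e3] at h
  have hx2 : x ^ 2 ≤ 1 := pow_le_one₀ h0.le h1
  calc _ = _ := by
        congr 1
        field_simp
        ring
    _ ≤ _ := h
    _ = 4 * x ^ 2 / (((n : ℝ) + 2) * (n + 3)) + 3 * (1 / 2) ^ (n + 1) := by
        rw [mul_pow, mul_pow, div_pow, one_pow]
        field_simp
        ring
    _ ≤ _ := by
        gcongr
        linarith

lemma tendsto_remainder_mul_self :
    Filter.Tendsto (fun n : ℕ => (4 / (((n : ℝ) + 2) * (n + 3)) + 3 * (1 / 2) ^ (n + 1)) * (n : ℝ))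
      Filter.atTop (nhds 0) := by
  have hg := (tendsto_self_mul_const_pow_of_lt_one (r := (1 / 2 : ℝ)) (by norm_num)
    (by norm_num)).const_mul (3 / 2)
  have hi := (tendsto_one_div_add_atTop_nhds_zero_nat (𝕜 := ℝ)).const_mul 4
  have hs := hi.add hg
  rw [mul_zero, mul_zero, add_zero] at hs
  refine squeeze_zero (fun n => by positivity) (fun n => ?_) hs
  have : 4 / (((n : ℝ) + 2) * (n + 3)) * n ≤ 4 * (1 / ((n : ℝ) + 1)) := by
    rw [div_mul_eq_mul_div, mul_one_div, div_le_div_iff₀ (by positivity) (by positivity)]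
    nlinarith [(Nat.cast_nonneg n : (0 : ℝ) ≤ n)]
  rw [pow_succ]
  linarith

theorem stmt19 (lam : ℝ) (hlam : 0 < lam ∧ lam ≤ 1) :
    Filter.Tendsto
      (fun n : ℕ => dtv (genMatch n lam) (poissonPmf lam)
        * (Nat.factorial (n + 1) : ℝ) / (2 ^ n * lam ^ (n + 1)))
      Filter.atTop (nhds 1) ∧
    Filter.Tendsto
      (fun n : ℕ => (dtv (genMatch n lam) (poissonPmf lam)
          * (Nat.factorial (n + 1) : ℝ) / (2 ^ n * lam ^ (n + 1))
          - 1 + 2 * lam / ((n : ℝ) + 2)) * (n : ℝ))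
      Filter.atTop (nhds 0) := by
  have hsecond : Filter.Tendsto
      (fun n : ℕ => (dtv (genMatch n lam) (poissonPmf lam)
          * (Nat.factorial (n + 1) : ℝ) / (2 ^ n * lam ^ (n + 1))
          - 1 + 2 * lam / ((n : ℝ) + 2)) * (n : ℝ))
      Filter.atTop (nhds 0) := by
    refine squeeze_zero_norm (fun n => ?_) tendsto_remainder_mul_self
    rw [Real.norm_eq_abs, abs_mul, abs_of_nonneg (Nat.cast_nonneg n : (0 : ℝ) ≤ n)]
    exact mul_le_mul_of_nonneg_right (abs_normalized_dtv_sub_le hlam.1 hlam.2 n)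
      (Nat.cast_nonneg n)
  refine ⟨?_, hsecond⟩
  have hinv : Filter.Tendsto (fun n : ℕ => ((n : ℝ))⁻¹) Filter.atTop (nhds 0) :=
    tendsto_inv_atTop_nhds_zero_nat
  have hlin : Filter.Tendsto (fun n : ℕ => 2 * lam / ((n : ℝ) + 2)) Filter.atTop (nhds 0) :=
    (Filter.tendsto_atTop_add_const_right _ 2 tendsto_natCast_atTop_atTop).const_div_atTop _
  have h := ((hsecond.mul hinv).sub hlin).add_const 1
  rw [mul_zero, sub_zero, zero_add] at h
  refine h.congr' ?_
  filter_upwards [Filter.eventually_ne_atTop 0] with n hn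
  rw [mul_inv_cancel_right₀ (Nat.cast_ne_zero.2 hn)]
  ring
end
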